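/- Let φ : ℝ×ℝ² → ℂ be a Schwartz function with φ(t,ξ) = 0 whenever t < 0, and let (R*φ)(x₁₂,x₃) = (1/(4π)) ∫_{ℝ²} φ(√(‖x₁₂−ξ‖² + x₃²), ξ) · (√(‖x₁₂−ξ‖² + x₃²))^{−1} dξ. Then for every (σ,ϱ) ∈ ℝ²×ℝ with (σ,ϱ) ≠ (0,0), setting s = √(‖σ‖² + ϱ²), the integral (2π)^{−3/2} ∫_{ℝ²×ℝ} (R*φ)(x₁₂,x₃) e^{i(σ·x₁₂ + ϱ x₃)} dx₁₂ dx₃ is absolutely convergent and equals (1/(2is)) · ( 𝓕φ(s,σ) − 𝓕φ(−s,σ) ). -/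

import Mathlib

open MeasureTheory Real Complex
open scoped RealInnerProductSpace

/-- Fourier transform on `ℝ × ℝ²`:
`𝓕f(ω,σ) = (2π)^{−3/2} ∫ f(t,ξ) e^{i(ωt + σ·ξ)} dt dξ`. -/
noncomputable def FT (f : ℝ × EuclideanSpace ℝ (Fin 2) → ℂ)
    (ω : ℝ) (σ : EuclideanSpace ℝ (Fin 2)) : ℂ :=
  (((2 * π : ℝ) ^ (-(3 : ℝ) / 2) : ℝ) : ℂ) *
    ∫ p : ℝ × EuclideanSpace ℝ (Fin 2),
      f p * Complex.exp (Complex.I * ((ω * p.1 + ⟪σ, p.2⟫ : ℝ) : ℂ))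

/-- Backprojection operator:
`(R*φ)(x₁₂,x₃) = (1/(4π)) ∫_{ℝ²} φ(√(‖x₁₂−ξ‖² + x₃²), ξ)·(√(‖x₁₂−ξ‖² + x₃²))⁻¹ dξ`. -/
noncomputable def Rstar (g : ℝ × EuclideanSpace ℝ (Fin 2) → ℂ)
    (x : EuclideanSpace ℝ (Fin 2) × ℝ) : ℂ :=
  ((1 / (4 * π) : ℝ) : ℂ) * ∫ ξ : EuclideanSpace ℝ (Fin 2),
    g (Real.sqrt (‖x.1 - ξ‖ ^ 2 + x.2 ^ 2), ξ) /
      ((Real.sqrt (‖x.1 - ξ‖ ^ 2 + x.2 ^ 2) : ℝ) : ℂ)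

abbrev EE := EuclideanSpace ℝ (Fin 2)

abbrev V3 := WithLp 2 (EE × ℝ)

instance haar_EE_R : (volume : Measure (EE × ℝ)).IsAddHaarMeasure :=
  Measure.prod.instIsAddHaarMeasure _ _

instance haar_R_EE : (volume : Measure (ℝ × EE)).IsAddHaarMeasure :=
  Measure.prod.instIsAddHaarMeasure _ _

/-- Integration of a radial profile over horizontal planes. -/
lemma plane_integral (f : ℝ → ℂ) (a : ℝ) :
    ∫ y : EE, f (√(‖y‖ ^ 2 + a ^ 2)) / ((√(‖y‖ ^ 2 + a ^ 2) : ℝ) : ℂ)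
      = 2 * π * ∫ r in Set.Ioi |a|, f r := by
  rw [integral_fun_norm_addHaar volume
    (fun t : ℝ => f (√(t ^ 2 + a ^ 2)) / ((√(t ^ 2 + a ^ 2) : ℝ) : ℂ))]
  have himg : (fun t : ℝ => √(t ^ 2 + a ^ 2)) '' Set.Ioi 0 = Set.Ioi |a| := by
    ext r
    simp only [Set.mem_image, Set.mem_Ioi]
    constructor
    · rintro ⟨t, ht, rfl⟩
      rw [← Real.sqrt_sq_eq_abs]
      apply Real.sqrt_lt_sqrt (sq_nonneg _)
      nlinarith
    · intro hr
      have h0 : 0 ≤ |a| := abs_nonneg a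
      have h1 : 0 < r ^ 2 - a ^ 2 := by
        rw [← sq_abs a]; nlinarith
      refine ⟨√(r ^ 2 - a ^ 2), Real.sqrt_pos.2 h1, ?_⟩
      rw [Real.sq_sqrt h1.le]
      simp [Real.sqrt_sq (h0.trans hr.le)]
  have key := integral_image_eq_integral_abs_deriv_smul (s := Set.Ioi (0:ℝ))
    (f := fun t : ℝ => √(t ^ 2 + a ^ 2)) (f' := fun t => t / √(t ^ 2 + a ^ 2))
    measurableSet_Ioi (by
      intro t ht
      have ht' : (0:ℝ) < t := ht
      have hp : t ^ 2 + a ^ 2 ≠ 0 := by positivity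
      have := (((hasDerivAt_pow 2 t).add_const (a ^ 2)).sqrt hp).hasDerivWithinAt (s := Set.Ioi 0)
      rw [show ((2 : ℕ) : ℝ) * t ^ (2 - 1) = 2 * t by norm_num,
        mul_div_mul_left _ _ two_ne_zero] at this
      exact this) (by
      intro t ht u hu h
      have ht' : (0:ℝ) < t := ht
      have hu' : (0:ℝ) < u := hu
      simp only at h
      rw [Real.sqrt_inj (by positivity) (by positivity)] at h
      nlinarith) f
  rw [himg] at key
  rw [key]
  have hv : (volume : Measure EE).real (Metric.ball 0 1) = π := by
    simp [Measure.real, EuclideanSpace.volume_ball_fin_two, Real.pi_pos.le]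
  rw [hv]
  simp only [finrank_euclideanSpace, Fintype.card_fin]
  rw [nsmul_eq_mul, Complex.real_smul, ← mul_assoc]
  push_cast
  congr 1
  refine setIntegral_congr_fun measurableSet_Ioi fun t ht => ?_
  have ht' : (0:ℝ) < t := ht
  simp only [Complex.real_smul]
  rw [abs_of_nonneg (by positivity)]
  push_cast
  ring

lemma exp_integral (s : ℝ) (hs : s ≠ 0) (r : ℝ) (hr : 0 < r) :
    ∫ a in Set.Ioo (-r) r, Complex.exp (I * ((s * a : ℝ) : ℂ))
      = 2 * Complex.sin (s * r) / s := by
  rw [← integral_Ioc_eq_integral_Ioo, ← intervalIntegral.integral_of_le (by linarith)]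
  have h : (I * s : ℂ) ≠ 0 := by simp [hs]
  have := integral_exp_mul_complex (a := -r) (b := r) h
  have hs' : (s:ℂ) ≠ 0 := by exact_mod_cast hs
  simp only [mul_assoc, ← Complex.ofReal_mul] at this
  rw [this, Complex.sin]
  push_cast
  field_simp
  rw [Complex.I_sq]
  ring_nf

/-- basic 3D integrability -/
lemma integrable_radial3 : Integrable (fun x : EE × ℝ =>
    ((√(‖x.1‖ ^ 2 + x.2 ^ 2)) * (1 + (√(‖x.1‖ ^ 2 + x.2 ^ 2)) ^ 2) ^ 2)⁻¹) := by
  have h : Integrable (fun x : WithLp 2 (EE × ℝ) => (‖x‖ * (1 + ‖x‖ ^ 2) ^ 2)⁻¹) := by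
    rw [integrable_fun_norm_addHaar volume (f := fun t : ℝ => (t * (1 + t ^ 2) ^ 2)⁻¹)]
    have hd : Module.finrank ℝ (WithLp 2 (EE × ℝ)) = 3 := by
      rw [(WithLp.linearEquiv 2 ℝ (EE × ℝ)).finrank_eq]
      simp
    rw [hd]
    refine (integrable_inv_one_add_sq.integrableOn (s := Set.Ioi 0)).mono' ?_ ?_
    · fun_prop
    · refine (ae_restrict_iff' measurableSet_Ioi).2 (.of_forall fun t ht => ?_)
      have ht' : (0:ℝ) < t := ht
      rw [Real.norm_of_nonneg (by simp; positivity)]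
      simp only [smul_eq_mul]
      norm_num
      field_simp
      nlinarith [sq_nonneg (t-1)]
  have := (WithLp.volume_preserving_toLp EE ℝ).integrable_comp_of_integrable h
  refine this.congr (.of_forall fun x => ?_)
  simp [WithLp.prod_norm_eq_of_L2]

lemma continuous_rad : Continuous (fun x : EE × ℝ => √(‖x.1‖ ^ 2 + x.2 ^ 2)) := by fun_prop

lemma integrable_g (f : ℝ → ℂ) (hf : Continuous f) (C : ℝ)
    (hC : ∀ r, ‖f r‖ ≤ C * ((1 + r ^ 2) ^ 2)⁻¹) (e : EE × ℝ → ℂ) (he : Continuous e)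
    (he1 : ∀ x, ‖e x‖ = 1) :
    Integrable (fun x : EE × ℝ =>
      f (√(‖x.1‖ ^ 2 + x.2 ^ 2)) / ((√(‖x.1‖ ^ 2 + x.2 ^ 2) : ℝ) : ℂ) * e x) := by
  refine (integrable_radial3.const_mul C).mono' ?_ (.of_forall fun x => ?_)
  · have := continuous_rad
    apply Measurable.aestronglyMeasurable
    apply Measurable.mul
    · exact ((hf.comp this).measurable).div (by fun_prop)
    · exact he.measurable
  · rw [norm_mul, he1, mul_one, norm_div, Complex.norm_real, Real.norm_of_nonneg (Real.sqrt_nonneg _),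
      mul_inv, div_eq_mul_inv]
    have := mul_le_mul_of_nonneg_right (hC (√(‖x.1‖ ^ 2 + x.2 ^ 2)))
      (inv_nonneg.2 (Real.sqrt_nonneg (‖x.1‖ ^ 2 + x.2 ^ 2)))
    linarith

lemma axis_integral (f : ℝ → ℂ) (hf : Continuous f) (C : ℝ)
    (hC : ∀ r, ‖f r‖ ≤ C * ((1 + r ^ 2) ^ 2)⁻¹) (s : ℝ) (hs : s ≠ 0) :
    ∫ x : EE × ℝ, f (√(‖x.1‖ ^ 2 + x.2 ^ 2)) / ((√(‖x.1‖ ^ 2 + x.2 ^ 2) : ℝ) : ℂ) *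
        Complex.exp (I * ((s * x.2 : ℝ) : ℂ))
      = 4 * π / s * ∫ r in Set.Ioi 0, f r * Complex.sin (s * r) := by
  have hint := integrable_g f hf C hC (fun x => Complex.exp (I * ((s * x.2 : ℝ) : ℂ)))
    (by fun_prop) (fun x => by rw [mul_comm, Complex.norm_exp_ofReal_mul_I])
  rw [Measure.volume_eq_prod] at hint ⊢
  rw [integral_prod_symm _ hint]
  simp only [integral_mul_const, plane_integral]
  set T : Set (ℝ × ℝ) := {p | |p.1| < p.2} with hT
  have hTm : MeasurableSet T := measurableSet_lt (by fun_prop) (by fun_prop)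
  set H : ℝ × ℝ → ℂ := T.indicator (fun p => f p.2 * Complex.exp (I * ((s * p.1 : ℝ) : ℂ))) with hH
  have hHi : Integrable H (volume.prod volume) := by
    have h1 := (integrable_inv_one_add_sq.mul_prod integrable_inv_one_add_sq).const_mul C
    refine h1.mono' ?_ (.of_forall fun p => ?_)
    · refine AEStronglyMeasurable.indicator ?_ hTm
      exact Continuous.aestronglyMeasurable (by fun_prop)
    · by_cases hp : p ∈ T
      · rw [hH, Set.indicator_of_mem hp, norm_mul, mul_comm I, Complex.norm_exp_ofReal_mul_I, mul_one]
        refine (hC _).trans ?_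
        have hC0 : 0 ≤ C := by
          have := (norm_nonneg _).trans (hC 0)
          simpa using this
        rw [← mul_inv]
        apply mul_le_mul_of_nonneg_left _ hC0
        apply inv_anti₀ (by positivity)
        rw [sq (1 + p.2 ^ 2)]
        apply mul_le_mul_of_nonneg_right _ (by positivity)
        have : p.1 ^ 2 ≤ p.2 ^ 2 := by
          rw [← sq_abs p.1]
          exact pow_le_pow_left₀ (abs_nonneg _) (le_of_lt hp) 2
        linarith
      · rw [hH, Set.indicator_of_notMem hp, norm_zero]
        have hC0 : 0 ≤ C := by
          have := (norm_nonneg _).trans (hC 0)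
          simpa using this
        positivity
  have e1 : ∀ a : ℝ, (2 * π * ∫ r in Set.Ioi |a|, f r) * Complex.exp (I * ((s * a : ℝ) : ℂ))
      = 2 * π * ∫ r, H (a, r) := by
    intro a
    rw [mul_assoc, ← integral_mul_const, ← integral_indicator measurableSet_Ioi]
    rfl
  simp_rw [e1]
  rw [integral_const_mul, integral_integral_swap (f := fun a r => H (a, r)) hHi]
  have e2 : ∀ r : ℝ, ∫ a, H (a, r) =
      (Set.Ioi 0).indicator (fun r => f r * (2 * Complex.sin (s * r) / s)) r := by
    intro r
    have : (fun a => H (a, r)) = (Set.Ioo (-r) r).indicator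
        (fun a => f r * Complex.exp (I * ((s * a : ℝ) : ℂ))) := by
      ext a
      simp only [hH, hT, Set.indicator, Set.mem_ofPred_eq, abs_lt, Set.mem_Ioo]
    rw [this, integral_indicator measurableSet_Ioo, integral_const_mul]
    by_cases hr : 0 < r
    · rw [exp_integral s hs r hr, Set.indicator_of_mem (show r ∈ Set.Ioi 0 from hr)]
    · rw [Set.indicator_of_notMem (by simpa using hr), Set.Ioo_eq_empty (by linarith)]
      simp
  simp_rw [e2]
  rw [integral_indicator measurableSet_Ioi, ← integral_const_mul, ← integral_const_mul]
  congr 1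
  ext r
  ring

lemma general_integral (f : ℝ → ℂ) (hf : Continuous f) (C : ℝ)
    (hC : ∀ r, ‖f r‖ ≤ C * ((1 + r ^ 2) ^ 2)⁻¹) (σ : EE) (ϱ : ℝ)
    (hs : √(‖σ‖ ^ 2 + ϱ ^ 2) ≠ 0) :
    ∫ x : EE × ℝ, f (√(‖x.1‖ ^ 2 + x.2 ^ 2)) / ((√(‖x.1‖ ^ 2 + x.2 ^ 2) : ℝ) : ℂ) *
        Complex.exp (I * ((⟪σ, x.1⟫ + ϱ * x.2 : ℝ) : ℂ))
      = 4 * π / (√(‖σ‖ ^ 2 + ϱ ^ 2) : ℝ) *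
        ∫ r in Set.Ioi 0, f r * Complex.sin ((√(‖σ‖ ^ 2 + ϱ ^ 2) : ℝ) * r) := by
  rw [← axis_integral f hf C hC _ hs]
  set s := √(‖σ‖ ^ 2 + ϱ ^ 2) with hsdef
  have conv : ∀ k : EE × ℝ, 
      ∫ x : EE × ℝ, f (√(‖x.1‖ ^ 2 + x.2 ^ 2)) / ((√(‖x.1‖ ^ 2 + x.2 ^ 2) : ℝ) : ℂ) *
        Complex.exp (I * ((⟪k.1, x.1⟫ + k.2 * x.2 : ℝ) : ℂ))
      = ∫ x : V3, f ‖x‖ / ((‖x‖ : ℝ) : ℂ) * Complex.exp (I * ((⟪(WithLp.toLp 2 k : V3), x⟫ : ℝ) : ℂ)) := by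
    intro k
    rw [← (WithLp.volume_preserving_toLp EE ℝ).integral_comp
      (MeasurableEquiv.toLp 2 (EE × ℝ)).measurableEmbedding]
    congr 1
    ext x
    simp [WithLp.prod_norm_eq_of_L2, WithLp.prod_inner_apply, mul_comm]
  have c1 := conv (σ, ϱ)
  have c2 := conv (0, s)
  simp only [inner_zero_left, zero_add] at c1 c2
  rw [c1, c2]
  set v : V3 := WithLp.toLp 2 (σ, ϱ)
  set w : V3 := WithLp.toLp 2 ((0 : EE), s)
  have hn : ‖v‖ = ‖w‖ := by
    simp only [v, w, WithLp.prod_norm_eq_of_L2, norm_zero, Real.norm_eq_abs, sq_abs]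
    change √(‖σ‖ ^ 2 + ϱ ^ 2) = √(‖(0 : EE)‖ ^ 2 + √(‖σ‖ ^ 2 + ϱ ^ 2) ^ 2)
    rw [Real.sq_sqrt (by positivity)]
    simp
  let R : V3 ≃ₗᵢ[ℝ] V3 := (ℝ ∙ (w - v))ᗮ.reflection
  have hR : R w = v := Submodule.reflection_sub hn.symm
  rw [← R.measurePreserving.integral_comp R.toHomeomorph.measurableEmbedding]
  congr 1
  ext x
  rw [← hR, R.inner_map_map, R.norm_map]

lemma schwartz_bound (φ : SchwartzMap (ℝ × EE) ℂ) : ∃ C : ℝ, 0 ≤ C ∧ ∀ t ξ,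
    ‖φ (t, ξ)‖ ≤ C * ((1 + t ^ 2) ^ 2)⁻¹ * ((1 + ‖ξ‖ ^ 2) ^ 2)⁻¹ := by
  refine ⟨2 ^ 8 * (Finset.Iic (8, 0)).sup (fun m => SchwartzMap.seminorm ℝ m.1 m.2) φ,
    by positivity, fun t ξ => ?_⟩
  have h := SchwartzMap.one_add_le_sup_seminorm_apply (𝕜 := ℝ) (m := (8, 0)) (k := 8) (n := 0)
    le_rfl le_rfl φ (t, ξ)
  rw [norm_iteratedFDeriv_zero] at h
  rw [mul_assoc, ← mul_inv, ← div_eq_mul_inv, le_div_iff₀ (by positivity)]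
  refine le_trans ?_ h
  rw [mul_comm]
  apply mul_le_mul_of_nonneg_right _ (norm_nonneg _)
  have h1 : |t| ≤ ‖(t, ξ)‖ := norm_fst_le (t, ξ)
  have h2 : ‖ξ‖ ≤ ‖(t, ξ)‖ := norm_snd_le (t, ξ)
  generalize ‖(t, ξ)‖ = N at h1 h2
  have h0 : 0 ≤ N := (abs_nonneg t).trans h1
  have a1 : 1 + t ^ 2 ≤ (1 + N) ^ 2 := by
    rw [← sq_abs t]; nlinarith [abs_nonneg t]
  have a2 : 1 + ‖ξ‖ ^ 2 ≤ (1 + N) ^ 2 := by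
    nlinarith [norm_nonneg ξ]
  calc (1 + t ^ 2) ^ 2 * (1 + ‖ξ‖ ^ 2) ^ 2 ≤ ((1 + N) ^ 2) ^ 2 * ((1 + N) ^ 2) ^ 2 := by
        gcongr
    _ = (1 + N) ^ 8 := by ring

lemma integrable_xi : Integrable (fun ξ : EE => ((1 + ‖ξ‖ ^ 2) ^ 2)⁻¹) := by
  rw [integrable_fun_norm_addHaar volume (f := fun t : ℝ => ((1 + t ^ 2) ^ 2)⁻¹)]
  simp only [finrank_euclideanSpace, Fintype.card_fin]
  refine (integrable_inv_one_add_sq.integrableOn (s := Set.Ioi 0)).mono' ?_ ?_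
  · fun_prop
  · refine (ae_restrict_iff' measurableSet_Ioi).2 (.of_forall fun t ht => ?_)
    have ht' : (0:ℝ) < t := ht
    rw [Real.norm_of_nonneg (by simp; positivity)]
    simp only [smul_eq_mul]
    norm_num
    field_simp
    nlinarith [sq_nonneg (t-1)]

lemma G_integrable (φ : SchwartzMap (ℝ × EE) ℂ) (σ : EE) (ϱ : ℝ) :
    Integrable (fun p : EE × (EE × ℝ) =>
      φ (√(‖p.2.1‖ ^ 2 + p.2.2 ^ 2), p.1) / ((√(‖p.2.1‖ ^ 2 + p.2.2 ^ 2) : ℝ) : ℂ) *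
        Complex.exp (I * ((⟪σ, p.2.1 + p.1⟫ + ϱ * p.2.2 : ℝ) : ℂ))) (volume.prod volume) := by
  obtain ⟨C, hC0, hC⟩ := schwartz_bound φ
  have h := (integrable_xi.mul_prod integrable_radial3).const_mul C
  refine h.mono' ?_ (.of_forall fun p => ?_)
  · apply Measurable.aestronglyMeasurable
    apply Measurable.mul
    · have : Continuous fun p : EE × (EE × ℝ) => φ (√(‖p.2.1‖ ^ 2 + p.2.2 ^ 2), p.1) :=
        φ.continuous.comp (by fun_prop)
      exact this.measurable.div (by fun_prop)
    · exact Continuous.measurable (by fun_prop)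
  · rw [norm_mul, mul_comm I, Complex.norm_exp_ofReal_mul_I, mul_one, norm_div, Complex.norm_real,
      Real.norm_of_nonneg (Real.sqrt_nonneg _), mul_inv, div_eq_mul_inv]
    have := mul_le_mul_of_nonneg_right (hC (√(‖p.2.1‖ ^ 2 + p.2.2 ^ 2)) p.1)
      (inv_nonneg.2 (Real.sqrt_nonneg (‖p.2.1‖ ^ 2 + p.2.2 ^ 2)))
    refine this.trans (le_of_eq ?_)
    ring

lemma F_integrable (φ : SchwartzMap (ℝ × EE) ℂ) (σ : EE) (ϱ : ℝ) :
    Integrable (fun p : (EE × ℝ) × EE =>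
      φ (√(‖p.1.1 - p.2‖ ^ 2 + p.1.2 ^ 2), p.2) / ((√(‖p.1.1 - p.2‖ ^ 2 + p.1.2 ^ 2) : ℝ) : ℂ) *
        Complex.exp (I * ((⟪σ, p.1.1⟫ + ϱ * p.1.2 : ℝ) : ℂ))) (volume.prod volume) := by
  have mp : MeasurePreserving (fun p : EE × (EE × ℝ) => (p.1, p.2 - (p.1, (0:ℝ))))
      (volume.prod volume) (volume.prod volume) := by
    refine MeasurePreserving.skew_product (g := fun (ξ : EE) (x : EE × ℝ) => x - (ξ, (0:ℝ)))
      (MeasurePreserving.id _) ?_ (.of_forall fun ξ => ?_)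
    · exact Continuous.measurable (by fun_prop)
    · exact (measurePreserving_sub_right volume ((ξ, 0) : EE × ℝ)).map_eq
  have := (mp.integrable_comp_of_integrable (G_integrable φ σ ϱ)).swap
  refine this.congr (.of_forall fun p => ?_)
  simp [Function.comp]

lemma phi_integrable (φ : SchwartzMap (ℝ × EE) ℂ) (ω : ℝ) (σ : EE) :
    Integrable (fun p : ℝ × EE => φ p * Complex.exp (I * ((ω * p.1 + ⟪σ, p.2⟫ : ℝ) : ℂ)))
      (volume.prod volume) := by
  have h : Integrable (fun p : ℝ × EE => φ p) (volume.prod volume) := by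
    rw [← Measure.volume_eq_prod]
    exact φ.integrable
  refine h.norm.mono' ?_ (.of_forall fun p => ?_)
  · have := φ.continuous
    exact Continuous.aestronglyMeasurable (by fun_prop)
  · rw [norm_mul, mul_comm I, Complex.norm_exp_ofReal_mul_I, mul_one]

lemma slice (φ : SchwartzMap (ℝ × EE) ℂ) (σ : EE) (ϱ : ℝ)
    (hs : √(‖σ‖ ^ 2 + ϱ ^ 2) ≠ 0) (ξ : EE) :
    ∫ x : EE × ℝ, φ (√(‖x.1 - ξ‖ ^ 2 + x.2 ^ 2), ξ) / ((√(‖x.1 - ξ‖ ^ 2 + x.2 ^ 2) : ℝ) : ℂ) *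
        Complex.exp (I * ((⟪σ, x.1⟫ + ϱ * x.2 : ℝ) : ℂ))
      = Complex.exp (I * ((⟪σ, ξ⟫ : ℝ) : ℂ)) * (4 * π / (√(‖σ‖ ^ 2 + ϱ ^ 2) : ℝ) *
        ∫ r in Set.Ioi 0, φ (r, ξ) * Complex.sin ((√(‖σ‖ ^ 2 + ϱ ^ 2) : ℝ) * r)) := by
  obtain ⟨C, hC0, hC⟩ := schwartz_bound φ
  rw [← general_integral (fun r => φ (r, ξ)) (φ.continuous.comp (by fun_prop))
    (C * ((1 + ‖ξ‖ ^ 2) ^ 2)⁻¹) (fun r => (hC r ξ).trans (le_of_eq (by ring))) σ ϱ hs,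
    ← integral_const_mul, ← integral_add_right_eq_self _ ((ξ, 0) : EE × ℝ)]
  congr 1
  ext x
  simp only [Prod.fst_add, Prod.snd_add, add_sub_cancel_right, add_zero, inner_add_right]
  rw [mul_left_comm, ← Complex.exp_add]
  congr 2
  push_cast
  ring

lemma slice_FT (φ : SchwartzMap (ℝ × EE) ℂ)
    (hφ : ∀ (t : ℝ) (ξ : EE), t < 0 → φ (t, ξ) = 0) (s : ℝ) (σ : EE) :
    (∫ p : ℝ × EE, φ p * Complex.exp (I * ((s * p.1 + ⟪σ, p.2⟫ : ℝ) : ℂ))) -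
    (∫ p : ℝ × EE, φ p * Complex.exp (I * ((-s * p.1 + ⟪σ, p.2⟫ : ℝ) : ℂ)))
    = ∫ ξ : EE, 2 * I * (Complex.exp (I * ((⟪σ, ξ⟫ : ℝ) : ℂ)) *
        ∫ r in Set.Ioi 0, φ (r, ξ) * Complex.sin (s * r)) := by
  have h1 := phi_integrable φ s σ
  have h2 := phi_integrable φ (-s) σ
  rw [Measure.volume_eq_prod, ← integral_sub h1 h2, integral_prod_symm (fun p : ℝ × EE => _ - _) (h1.sub h2)]
  congr 1
  ext ξ
  rw [← integral_const_mul, ← integral_const_mul, ← integral_Ici_eq_integral_Ioi,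
    ← integral_indicator measurableSet_Ici]
  congr 1
  ext t
  by_cases ht : 0 ≤ t
  · rw [Set.indicator_of_mem (show t ∈ Set.Ici 0 from ht), Complex.sin]
    have e1 : Complex.exp (I * ((s * t + ⟪σ, ξ⟫ : ℝ) : ℂ))
        = Complex.exp (I * ((⟪σ, ξ⟫ : ℝ) : ℂ)) * Complex.exp (s * t * I) := by
      rw [← Complex.exp_add]; congr 1; push_cast; ring
    have e2 : Complex.exp (I * ((-s * t + ⟪σ, ξ⟫ : ℝ) : ℂ))
        = Complex.exp (I * ((⟪σ, ξ⟫ : ℝ) : ℂ)) * Complex.exp (-(s * t) * I) := by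
      rw [← Complex.exp_add]; congr 1; push_cast; ring
    simp only [e1, e2]
    ring_nf
    rw [Complex.I_sq]
    ring
  · rw [Set.indicator_of_notMem (by simpa using ht)]
    simp [hφ t ξ (not_le.1 ht)]

theorem stmt9 (φ : SchwartzMap (ℝ × EuclideanSpace ℝ (Fin 2)) ℂ)
    (hφ : ∀ (t : ℝ) (ξ : EuclideanSpace ℝ (Fin 2)), t < 0 → φ (t, ξ) = 0)
    (σ : EuclideanSpace ℝ (Fin 2)) (ϱ : ℝ) (hne : σ ≠ 0 ∨ ϱ ≠ 0) :
    Integrable (fun x : EuclideanSpace ℝ (Fin 2) × ℝ =>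
        Rstar (⇑φ) x * Complex.exp (Complex.I * ((⟪σ, x.1⟫ + ϱ * x.2 : ℝ) : ℂ))) ∧
    (((2 * π : ℝ) ^ (-(3 : ℝ) / 2) : ℝ) : ℂ) *
        (∫ x : EuclideanSpace ℝ (Fin 2) × ℝ,
          Rstar (⇑φ) x * Complex.exp (Complex.I * ((⟪σ, x.1⟫ + ϱ * x.2 : ℝ) : ℂ)))
      = (1 / (2 * Complex.I * ((Real.sqrt (‖σ‖ ^ 2 + ϱ ^ 2) : ℝ) : ℂ))) *
          (FT (⇑φ) (Real.sqrt (‖σ‖ ^ 2 + ϱ ^ 2)) σ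
            - FT (⇑φ) (-Real.sqrt (‖σ‖ ^ 2 + ϱ ^ 2)) σ) := by
  have hs : √(‖σ‖ ^ 2 + ϱ ^ 2) ≠ 0 := by
    rw [Real.sqrt_ne_zero (by positivity)]
    rcases hne with h | h
    · have := norm_pos_iff.2 h
      positivity
    · positivity
  have hF := F_integrable φ σ ϱ
  have hR : ∀ x : EE × ℝ,
      Rstar (⇑φ) x * Complex.exp (Complex.I * ((⟪σ, x.1⟫ + ϱ * x.2 : ℝ) : ℂ))
      = ((1 / (4 * π) : ℝ) : ℂ) * ∫ ξ : EE,
        φ (√(‖x.1 - ξ‖ ^ 2 + x.2 ^ 2), ξ) / ((√(‖x.1 - ξ‖ ^ 2 + x.2 ^ 2) : ℝ) : ℂ) *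
        Complex.exp (I * ((⟪σ, x.1⟫ + ϱ * x.2 : ℝ) : ℂ)) := by
    intro x
    rw [Rstar, integral_mul_const, mul_assoc]
  simp_rw [hR]
  refine ⟨hF.integral_prod_left.const_mul _, ?_⟩
  rw [integral_const_mul, integral_integral_swap (f := fun (x : EE × ℝ) (ξ : EE) =>
        φ (√(‖x.1 - ξ‖ ^ 2 + x.2 ^ 2), ξ) / ((√(‖x.1 - ξ‖ ^ 2 + x.2 ^ 2) : ℝ) : ℂ) *
        Complex.exp (I * ((⟪σ, x.1⟫ + ϱ * x.2 : ℝ) : ℂ))) hF]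
  simp_rw [slice φ σ ϱ hs]
  rw [FT, FT, ← mul_sub, slice_FT φ hφ, integral_const_mul]
  simp_rw [mul_left_comm (Complex.exp _)]
  rw [integral_const_mul]
  have hs' : ((√(‖σ‖ ^ 2 + ϱ ^ 2) : ℝ) : ℂ) ≠ 0 := by exact_mod_cast hs
  have hpi : (π : ℂ) ≠ 0 := by exact_mod_cast Real.pi_ne_zero
  push_cast
  field_simp
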